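/- Let W be a cochain complex of vector spaces over a field K, and let U, V, Z be subcomplexes of W with U ⊆ V, U ⊆ Z and U = V ∩ Z. Assume the inclusions U → V and Z → W are quasi-isomorphisms. Then the two inclusions α: L_{Z,W} ∩ L_{V,W} → L_{U,V,W} and β: L_{Z,W} ∩ L_{V,W} → L_{U,Z,W} are quasi-isomorphisms; indeed the cokernel of α is isomorphic, as a complex, to Hom*(Z/U, W/Z) and the cokernel of β to Hom*(V/U, W/V), and these are acyclic. -/

import Mathlib

universe u

/-- A cochain complex of `K`-vector spaces, given by its components and its
degree-one differential.  (The condition `d ∘ d = 0` is `Cx.IsComplex`.) -/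
structure Cx (K : Type u) [Field K] where
  V : ℤ → Type u
  [acg : ∀ i, AddCommGroup (V i)]
  [mod : ∀ i, Module K (V i)]
  d : ∀ i, V i →ₗ[K] V (i + 1)

attribute [instance] Cx.acg Cx.mod

/-- Transport along an equality of degrees. -/
def castL (K : Type u) [Field K] (V : ℤ → Type u) [∀ i, AddCommGroup (V i)] [∀ i, Module K (V i)] {i j : ℤ}
    (h : i = j) : V i →ₗ[K] V j where
  toFun x := h ▸ x
  map_add' := by subst h; intros; rfl
  map_smul' := by subst h; intros; rfl

variable {K : Type u} [Field K]

/-- The differential squares to zero. -/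
def Cx.IsComplex (A : Cx K) : Prop := ∀ (i : ℤ) (x : A.V i), A.d (i + 1) (A.d i x) = 0

/-- A family of linear maps is a morphism of complexes if it commutes with the
differentials. -/
def IsChainMap (A B : Cx K) (f : ∀ i, A.V i →ₗ[K] B.V i) : Prop :=
  ∀ (i : ℤ) (x : A.V i), f (i + 1) (A.d i x) = B.d i (f i x)

/-- A morphism of complexes is a quasi-isomorphism if it induces an isomorphism on
cohomology in every degree: a cocycle of `A` whose image is a coboundary is a
coboundary, and every cocycle of `B` is, modulo coboundaries, the image of a
cocycle of `A`. -/
def IsQuasiIso (A B : Cx K) (f : ∀ i, A.V i →ₗ[K] B.V i) : Prop :=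
  ∀ n : ℤ,
    (∀ x : A.V (n + 1), A.d (n + 1) x = 0 → (∃ w, B.d n w = f (n + 1) x) →
      ∃ v, A.d n v = x) ∧
    (∀ y : B.V (n + 1), B.d (n + 1) y = 0 →
      ∃ x : A.V (n + 1), A.d (n + 1) x = 0 ∧ ∃ w, B.d n w = y - f (n + 1) x)

/-- A complex is acyclic if all its cohomology vanishes. -/
def Cx.Acyclic (A : Cx K) : Prop :=
  ∀ (n : ℤ) (x : A.V (n + 1)), A.d (n + 1) x = 0 → ∃ y, A.d n y = x


/-- The degree-`n` component `Hom^n(A, B) = Π_j Hom(A^j, B^{j+n})` of the Hom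
complex. -/
abbrev homV (A B : Cx K) (n : ℤ) : Type u := ∀ j : ℤ, A.V j →ₗ[K] B.V (j + n)

/-- The differential `δ(f) = d_B ∘ f − (−1)ⁿ f ∘ d_A` of the Hom complex. -/
def homD (A B : Cx K) (n : ℤ) : homV A B n →ₗ[K] homV A B (n + 1) where
  toFun f := fun j =>
    castL K B.V (show j + n + 1 = j + (n + 1) by omega) ∘ₗ B.d (j + n) ∘ₗ f j -
      ((-1 : K) ^ n) • (castL K B.V (show j + 1 + n = j + (n + 1) by omega) ∘ₗ
        f (j + 1) ∘ₗ A.d j)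
  map_add' f g := by
    funext j; ext x
    simp [smul_add]
    abel
  map_smul' c f := by
    funext j; ext x
    simp [smul_comm c, smul_sub]

/-- The Hom complex `Hom*(A, B)`. -/
def homCx (A B : Cx K) : Cx K where
  V n := homV A B n
  d n := homD A B n

/-- The subcomplex determined by a family of submodules preserved by the
differential. -/
def subCx (W : Cx K) (S : ∀ i, Submodule K (W.V i))
    (hS : ∀ i, ∀ x ∈ S i, W.d i x ∈ S (i + 1)) : Cx K where
  V i := ↥(S i)
  d i := (W.d i).restrict (hS i)

/-- The submodule `L_{V,W}^n ⊆ Hom^n(W, W)` of homogeneous maps preserving the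
subcomplex `S`. -/
def presSub (W : Cx K) (S : ∀ i, Submodule K (W.V i)) (n : ℤ) :
    Submodule K (homV W W n) where
  carrier := { f | ∀ j, ∀ x ∈ S j, f j x ∈ S (j + n) }
  add_mem' hf hg j x hx := by
    simpa using Submodule.add_mem _ (hf j x hx) (hg j x hx)
  zero_mem' j x hx := by simp
  smul_mem' c f hf j x hx := by
    simpa using Submodule.smul_mem _ c (hf j x hx)

lemma mem_presSub {W : Cx K} {S : ∀ i, Submodule K (W.V i)} {n : ℤ} {f : homV W W n} :
    f ∈ presSub W S n ↔ ∀ j, ∀ x ∈ S j, f j x ∈ S (j + n) := Iff.rfl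

lemma castL_mem {V : ℤ → Type u} [∀ i, AddCommGroup (V i)] [∀ i, Module K (V i)]
    (S : ∀ i, Submodule K (V i)) {i j : ℤ} (h : i = j) {x : V i} (hx : x ∈ S i) :
    castL K V h x ∈ S j := by subst h; exact hx

lemma homD_pres (W : Cx K) (S : ∀ i, Submodule K (W.V i))
    (hS : ∀ i, ∀ x ∈ S i, W.d i x ∈ S (i + 1)) (n : ℤ) :
    ∀ f ∈ presSub W S n, homD W W n f ∈ presSub W S (n + 1) := by
  intro f hf j x hx
  show (homD W W n f) j x ∈ _
  simp only [homD, LinearMap.coe_mk, AddHom.coe_mk, Pi.sub_apply, Pi.smul_apply,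
    LinearMap.sub_apply, LinearMap.smul_apply, LinearMap.comp_apply]
  exact Submodule.sub_mem _ (castL_mem S _ (hS _ _ (hf j x hx)))
    (Submodule.smul_mem _ _ (castL_mem S _ (hf (j + 1) _ (hS j x hx))))

/-- The subcomplex `L_{V,W} ⊆ Hom*(W, W)` of maps preserving `S`, as a complex. -/
def presCx (W : Cx K) (S : ∀ i, Submodule K (W.V i))
    (hS : ∀ i, ∀ x ∈ S i, W.d i x ∈ S (i + 1)) : Cx K where
  V n := ↥(presSub W S n)
  d n := (homD W W n).restrict (homD_pres W S hS n)

lemma homD_pres2 (W : Cx K) (S T : ∀ i, Submodule K (W.V i))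
    (hS : ∀ i, ∀ x ∈ S i, W.d i x ∈ S (i + 1))
    (hT : ∀ i, ∀ x ∈ T i, W.d i x ∈ T (i + 1)) (n : ℤ) :
    ∀ f ∈ presSub W S n ⊓ presSub W T n,
      homD W W n f ∈ presSub W S (n + 1) ⊓ presSub W T (n + 1) := by
  intro f hf
  rcases Submodule.mem_inf.mp hf with ⟨h1, h2⟩
  exact Submodule.mem_inf.mpr ⟨homD_pres W S hS n f h1, homD_pres W T hT n f h2⟩

/-- The subcomplex of `Hom*(W, W)` of maps preserving two given subcomplexes,
as a complex; for `S = U`, `T = V` this is `L_{U,V,W} = L_{U,W} ∩ L_{V,W}`. -/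
def presCx2 (W : Cx K) (S T : ∀ i, Submodule K (W.V i))
    (hS : ∀ i, ∀ x ∈ S i, W.d i x ∈ S (i + 1))
    (hT : ∀ i, ∀ x ∈ T i, W.d i x ∈ T (i + 1)) : Cx K where
  V n := ↥(presSub W S n ⊓ presSub W T n)
  d n := (homD W W n).restrict (homD_pres2 W S T hS hT n)

/-- The quotient complex of a complex by a family of submodules preserved by the
differential. -/
def quotOf (C : Cx K) (P : ∀ i, Submodule K (C.V i))
    (hP : ∀ i, ∀ x ∈ P i, C.d i x ∈ P (i + 1)) : Cx K where
  V i := C.V i ⧸ P i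
  d i := Submodule.mapQ (P i) (P (i + 1)) (C.d i) (fun x hx => hP i x hx)

section
variable (W : Cx K) (SV SZ : ∀ i, Submodule K (W.V i))

/-- `U = V ∩ Z`. -/
def SUfam : ∀ i, Submodule K (W.V i) := fun i => SV i ⊓ SZ i

lemma SUfam_pres (hV : ∀ i, ∀ x ∈ SV i, W.d i x ∈ SV (i + 1))
    (hZ : ∀ i, ∀ x ∈ SZ i, W.d i x ∈ SZ (i + 1)) :
    ∀ i, ∀ x ∈ SUfam W SV SZ i, W.d i x ∈ SUfam W SV SZ (i + 1) :=
  fun i x hx => Submodule.mem_inf.mpr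
    ⟨hV i x (Submodule.mem_inf.mp hx).1, hZ i x (Submodule.mem_inf.mp hx).2⟩

/-- Maps preserving `Z` and `V` preserve `U = V ∩ Z` (and `V`):  the inclusion
`L_{Z,W} ∩ L_{V,W} ⊆ L_{U,V,W}`. -/
lemma presSub_ZV_le_UV (n : ℤ) :
    presSub W SZ n ⊓ presSub W SV n ≤
      presSub W (SUfam W SV SZ) n ⊓ presSub W SV n := by
  intro f hf
  rcases Submodule.mem_inf.mp hf with ⟨h1, h2⟩
  refine Submodule.mem_inf.mpr ⟨fun j x hx => Submodule.mem_inf.mpr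
    ⟨h2 j x (Submodule.mem_inf.mp hx).1, h1 j x (Submodule.mem_inf.mp hx).2⟩, h2⟩

/-- The inclusion `L_{Z,W} ∩ L_{V,W} ⊆ L_{U,Z,W}`. -/
lemma presSub_ZV_le_UZ (n : ℤ) :
    presSub W SZ n ⊓ presSub W SV n ≤
      presSub W (SUfam W SV SZ) n ⊓ presSub W SZ n := by
  intro f hf
  rcases Submodule.mem_inf.mp hf with ⟨h1, h2⟩
  refine Submodule.mem_inf.mpr ⟨fun j x hx => Submodule.mem_inf.mpr
    ⟨h2 j x (Submodule.mem_inf.mp hx).1, h1 j x (Submodule.mem_inf.mp hx).2⟩, h1⟩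

/-- The quotient complex `Z/U`. -/
def ZmodU (hV : ∀ i, ∀ x ∈ SV i, W.d i x ∈ SV (i + 1))
    (hZ : ∀ i, ∀ x ∈ SZ i, W.d i x ∈ SZ (i + 1)) : Cx K :=
  quotOf (subCx W SZ hZ) (fun i => (SUfam W SV SZ i).comap (SZ i).subtype)
    (fun i x hx => SUfam_pres W SV SZ hV hZ i x.1 hx)

/-- The quotient complex `W/Z`. -/
def WmodZ (hZ : ∀ i, ∀ x ∈ SZ i, W.d i x ∈ SZ (i + 1)) : Cx K :=
  quotOf W SZ hZ

/-- The quotient complex `V/U`. -/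
def VmodU (hV : ∀ i, ∀ x ∈ SV i, W.d i x ∈ SV (i + 1))
    (hZ : ∀ i, ∀ x ∈ SZ i, W.d i x ∈ SZ (i + 1)) : Cx K :=
  quotOf (subCx W SV hV) (fun i => (SUfam W SV SZ i).comap (SV i).subtype)
    (fun i x hx => SUfam_pres W SV SZ hV hZ i x.1 hx)

/-- The quotient complex `W/V`. -/
def WmodV (hV : ∀ i, ∀ x ∈ SV i, W.d i x ∈ SV (i + 1)) : Cx K :=
  quotOf W SV hV

end

section helpers

lemma castL_rfl {V : ℤ → Type u} [∀ i, AddCommGroup (V i)] [∀ i, Module K (V i)]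
    {i : ℤ} (h : i = i) (x : V i) : castL K V h x = x := rfl

lemma castL_castL {V : ℤ → Type u} [∀ i, AddCommGroup (V i)] [∀ i, Module K (V i)]
    {i j k : ℤ} (h : i = j) (h' : j = k) (x : V i) :
    castL K V h' (castL K V h x) = castL K V (h.trans h') x := by
  subst h; subst h'; rfl

/-- Naturality of transport. -/
lemma castL_nat {V V' : ℤ → Type u} [∀ i, AddCommGroup (V i)] [∀ i, Module K (V i)]
    [∀ i, AddCommGroup (V' i)] [∀ i, Module K (V' i)] (e e' : ℤ → ℤ)
    (f : ∀ i, V (e i) →ₗ[K] V' (e' i)) {i j : ℤ} (h : i = j) (x : V (e i)) :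
    f j (castL K V (congrArg e h) x) = castL K V' (congrArg e' h) (f i x) := by
  subst h; rfl

lemma castL_d (B : Cx K) {i j : ℤ} (h : i = j) (x : B.V i) :
    B.d j (castL K B.V h x) = castL K B.V (congrArg (· + 1) h) (B.d i x) :=
  castL_nat (fun i => i) (fun i => i + 1) B.d h x

lemma castL_hom (A B : Cx K) {n : ℤ} (f : homV A B n) {i j : ℤ} (h : i = j) (x : A.V i) :
    f j (castL K A.V h x) = castL K B.V (congrArg (· + n) h) (f i x) :=
  castL_nat (fun i => i) (fun i => i + n) f h x

lemma homD_apply (A B : Cx K) (n : ℤ) (f : homV A B n) (j : ℤ) (x : A.V j) :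
    homD A B n f j x = castL K B.V (show j + n + 1 = j + (n + 1) by omega) (B.d (j + n) (f j x)) -
      ((-1 : K) ^ n) • (castL K B.V (show j + 1 + n = j + (n + 1) by omega)
        (f (j + 1) (A.d j x))) := rfl

lemma negpow_succ (n : ℤ) : (-1 : K) ^ (n + 1) = - (-1 : K) ^ n := by
  rw [zpow_add_one₀ (by simp)]; simp

lemma negpow_mul (n : ℤ) : (-1 : K) ^ n * (-1 : K) ^ n = 1 := by
  rw [← mul_zpow]; simp

lemma homD_homD (A B : Cx K) (hA : A.IsComplex) (hB : B.IsComplex) (n : ℤ) (f : homV A B n) :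
    homD A B (n + 1) (homD A B n f) = 0 := by
  funext j; ext x
  have h1 : ∀ y, B.d (j + n + 1) (B.d (j + n) y) = 0 := hB _
  simp only [homD_apply, map_sub, map_smul, castL_d, castL_castL, hA j x, h1, map_zero,
    negpow_succ, smul_zero, neg_smul, sub_zero, zero_sub]
  simp only [map_neg, map_smul, castL_castL]
  simp

/-- A contracting homotopy of an acyclic complex of vector spaces. -/
lemma exists_contraction (B : Cx K) (hB : B.IsComplex) (hac : B.Acyclic) :
    ∃ h : ∀ j, B.V (j + 1) →ₗ[K] B.V j,
      ∀ j y, B.d j (h j y) + h (j + 1) (B.d (j + 1) y) = y := by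
  have hs : ∀ j, ∃ s : B.V (j + 1) →ₗ[K] B.V j, ∀ x, B.d j (s (B.d j x)) = B.d j x := by
    intro j
    obtain ⟨t, ht⟩ := (B.d j).rangeRestrict.exists_rightInverse_of_surjective
      (LinearMap.range_rangeRestrict _)
    obtain ⟨s, hs⟩ := LinearMap.exists_extend t
    refine ⟨s, fun x => ?_⟩
    have h1 := LinearMap.congr_fun hs ⟨B.d j x, x, rfl⟩
    have h2 := congrArg Subtype.val (LinearMap.congr_fun ht ⟨B.d j x, x, rfl⟩)
    simp only [LinearMap.comp_apply, Submodule.subtype_apply] at h1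
    rw [h1]
    exact h2
  choose s hs using hs
  refine ⟨fun j => s j ∘ₗ (LinearMap.id - s (j + 1) ∘ₗ B.d (j + 1)), fun j y => ?_⟩
  have hc : B.d (j + 1) (y - s (j + 1) (B.d (j + 1) y)) = 0 := by
    rw [map_sub, hs, sub_self]
  obtain ⟨w, hw⟩ := hac j _ hc
  simp only [LinearMap.comp_apply, LinearMap.sub_apply, LinearMap.id_apply]
  rw [hB (j + 1) y, map_zero, sub_zero, ← hw, hs, hw]
  abel

lemma acyclic_hom_right (A B : Cx K) (hB : B.IsComplex) (hac : B.Acyclic) :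
    (homCx A B).Acyclic := by
  obtain ⟨h, hh⟩ := exists_contraction B hB hac
  intro n g hg
  change homV A B (n + 1) at g
  change homD A B (n + 1) g = 0 at hg
  refine ⟨fun j => h (j + n) ∘ₗ castL K B.V (show j + (n + 1) = j + n + 1 by omega) ∘ₗ g j, ?_⟩
  change homD A B n _ = g
  funext j; ext x
  have hgx := LinearMap.congr_fun (congrFun hg j) x
  rw [homD_apply, negpow_succ, neg_smul, sub_neg_eq_add] at hgx
  have hgx' : castL K B.V (by omega) (B.d (j + (n + 1)) (g j x)) +
    (-1 : K) ^ n • castL K B.V _ (g (j + 1) (A.d j x)) = (0 : B.V (j + (n + 1 + 1))) := hgx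
  rw [homD_apply]
  simp only [LinearMap.comp_apply]
  have key := hh (j + n) (castL K B.V (show j + (n + 1) = j + n + 1 by omega) (g j x))
  have h1 : castL K B.V (show j + 1 + n = j + (n + 1) by omega)
      (h (j + 1 + n) (castL K B.V (show j + 1 + (n + 1) = j + 1 + n + 1 by omega)
        (g (j + 1) (A.d j x)))) =
      castL K B.V (show j + n + 1 = j + (n + 1) by omega)
      (h (j + n + 1) (castL K B.V (show j + 1 + (n + 1) = j + n + 1 + 1 by omega)
        (g (j + 1) (A.d j x)))) := by
    have := castL_nat (fun i => i + 1) (fun i => i) h (show j + 1 + n = j + n + 1 by omega)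
      (castL K B.V (show j + 1 + (n + 1) = j + 1 + n + 1 by omega) (g (j + 1) (A.d j x)))
    rw [castL_castL] at this
    rw [this, castL_castL]
  rw [h1, ← map_smul, ← map_sub, ← map_smul, ← map_smul]
  have h2 : castL K B.V (show j + (n + 1) + 1 = j + n + 1 + 1 by omega)
      (B.d (j + (n + 1)) (g j x)) =
      - castL K B.V (show j + 1 + (n + 1) = j + n + 1 + 1 by omega)
        ((-1 : K) ^ n • g (j + 1) (A.d j x)) := by
    have := congrArg (castL K B.V (show j + (n + 1 + 1) = j + n + 1 + 1 by omega)) hgx'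
    rw [map_add, castL_castL, map_smul, castL_castL, map_zero] at this
    rw [map_smul]
    exact eq_neg_of_add_eq_zero_left this
  rw [castL_d, h2, map_neg, ← sub_eq_add_neg] at key
  rw [key, castL_castL, castL_rfl]

lemma acyclic_hom_left (A B : Cx K) (hA : A.IsComplex) (hac : A.Acyclic) :
    (homCx A B).Acyclic := by
  obtain ⟨h, hh⟩ := exists_contraction A hA hac
  intro n g hg
  change homV A B (n + 1) at g
  change homD A B (n + 1) g = 0 at hg
  let k : homV A B n := fun j => (-1 : K) ^ (n + 1) •
    (castL K B.V (show j - 1 + (n + 1) = j + n by omega) ∘ₗ g (j - 1) ∘ₗ h (j - 1) ∘ₗ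
      castL K A.V (show j = j - 1 + 1 by omega))
  have hk : ∀ p x, k (p + 1) x = (-1 : K) ^ (n + 1) •
      castL K B.V (show p + (n + 1) = p + 1 + n by omega) (g p (h p x)) := by
    have : ∀ p q (hq : q = p) (h1 : p + 1 = q + 1) (h2 : q + (n + 1) = p + 1 + n)
        (x : A.V (p + 1)),
        castL K B.V h2 (g q (h q (castL K A.V h1 x))) =
        castL K B.V (show p + (n + 1) = p + 1 + n by omega) (g p (h p x)) := by
      intro p q hq h1 h2 x
      subst hq; rfl
    intro p x
    change (-1 : K) ^ (n + 1) • castL K B.V _ (g (p + 1 - 1) (h (p + 1 - 1) (castL K A.V _ x))) = _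
    rw [this p (p + 1 - 1) (by omega)]
  refine ⟨k, ?_⟩
  change homD A B n k = g
  funext j
  obtain ⟨p, rfl⟩ : ∃ p, j = p + 1 := ⟨j - 1, by omega⟩
  ext x
  have hgx := LinearMap.congr_fun (congrFun hg p) (h p x)
  rw [homD_apply] at hgx
  have hgx' := sub_eq_zero.mp hgx
  have h2 : castL K B.V (show p + (n + 1) + 1 = p + 1 + (n + 1) by omega)
      (B.d (p + (n + 1)) (g p (h p x))) = (-1 : K) ^ (n + 1) • g (p + 1) (A.d p (h p x)) := by
    have := congrArg (castL K B.V (show p + (n + 1 + 1) = p + 1 + (n + 1) by omega)) hgx'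
    rw [castL_castL, map_smul, castL_castL, castL_rfl] at this
    exact this
  rw [homD_apply, hk, hk, map_smul, map_smul, castL_d, castL_castL, h2, map_smul, castL_castL,
    castL_rfl, smul_smul, smul_smul, negpow_mul, one_smul, negpow_succ, mul_neg, negpow_mul,
    neg_smul, one_smul, sub_neg_eq_add, ← map_add, hh]

lemma quot_isComplex (C : Cx K) (hC : C.IsComplex) (P : ∀ i, Submodule K (C.V i))
    (hP : ∀ i, ∀ x ∈ P i, C.d i x ∈ P (i + 1)) : (quotOf C P hP).IsComplex := by
  intro i x
  obtain ⟨y, rfl⟩ := Submodule.mkQ_surjective (P i) x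
  change Submodule.mkQ (P (i + 1 + 1)) (C.d (i + 1) (C.d i y)) = 0
  rw [hC, map_zero]

lemma sub_isComplex (W : Cx K) (hW : W.IsComplex) (S : ∀ i, Submodule K (W.V i))
    (hS : ∀ i, ∀ x ∈ S i, W.d i x ∈ S (i + 1)) : (subCx W S hS).IsComplex :=
  fun i x => Subtype.ext (hW i x.1)

lemma quot_acyclic (A B : Cx K) (hB : B.IsComplex) (f : ∀ i, A.V i →ₗ[K] B.V i)
    (hf : IsChainMap A B f) (hinj : ∀ i, Function.Injective (f i)) (hq : IsQuasiIso A B f)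
    (P : ∀ i, Submodule K (B.V i)) (hP : ∀ i, ∀ x ∈ P i, B.d i x ∈ P (i + 1))
    (hr : ∀ i b, b ∈ P i ↔ ∃ a, f i a = b) : (quotOf B P hP).Acyclic := by
  intro n x hx
  obtain ⟨y, rfl⟩ := Submodule.mkQ_surjective (P (n + 1)) x
  have hx' : Submodule.mkQ (P (n + 1 + 1)) (B.d (n + 1) y) = 0 := hx
  rw [Submodule.mkQ_apply, Submodule.Quotient.mk_eq_zero, hr] at hx'
  obtain ⟨a, ha⟩ := hx'
  have ha0 : A.d (n + 1 + 1) a = 0 := by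
    apply hinj
    rw [hf, ha, hB, map_zero]
  obtain ⟨v, hv⟩ := (hq (n + 1)).1 a ha0 ⟨y, ha.symm⟩
  obtain ⟨c, -, w, hw⟩ := (hq n).2 (y - f (n + 1) v) (by
    rw [map_sub, ← hf, hv, ha, sub_self])
  refine ⟨Submodule.mkQ (P n) w, ?_⟩
  change Submodule.mkQ (P (n + 1)) (B.d n w) = Submodule.mkQ (P (n + 1)) y
  rw [hw]
  simp only [Submodule.mkQ_apply]
  rw [Submodule.Quotient.eq, hr]
  exact ⟨-v - c, by simp only [map_sub, map_neg]; abel⟩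

lemma quasiIso_of_coker (A C D : Cx K) (hC : C.IsComplex) (f : ∀ i, A.V i →ₗ[K] C.V i)
    (hf : IsChainMap A C f) (hinj : ∀ i, Function.Injective (f i))
    (s : ∀ i, C.V i →ₗ[K] D.V i) (hs : IsChainMap C D s)
    (hsurj : ∀ i, Function.Surjective (s i))
    (hker : ∀ i c, s i c = 0 ↔ ∃ a, f i a = c) (hD : D.Acyclic) : IsQuasiIso A C f := by
  intro n
  constructor
  · rintro x hx ⟨w, hw⟩
    obtain ⟨m, rfl⟩ : ∃ m, n = m + 1 := ⟨n - 1, by omega⟩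
    have h0 : D.d (m + 1) (s (m + 1) w) = 0 := by
      rw [← hs, hw, hker]; exact ⟨x, rfl⟩
    obtain ⟨y, hy⟩ := hD m _ h0
    obtain ⟨c, rfl⟩ := hsurj m y
    obtain ⟨v, hv⟩ := (hker (m + 1) (w - C.d m c)).1 (by rw [map_sub, hs, hy, sub_self])
    refine ⟨v, hinj _ ?_⟩
    rw [hf, hv, map_sub, hC, sub_zero, hw]
  · intro y hy
    obtain ⟨e, he⟩ := hD n (s (n + 1) y) (by rw [← hs, hy, map_zero])
    obtain ⟨c, rfl⟩ := hsurj n e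
    obtain ⟨x, hx⟩ := (hker (n + 1) (y - C.d n c)).1 (by rw [map_sub, hs, he, sub_self])
    refine ⟨x, hinj _ ?_, c, ?_⟩
    · rw [hf, hx, map_sub, hC, hy, sub_zero, map_zero]
    · rw [hx]; abel

lemma castL_mkQ (C : Cx K) (P : ∀ i, Submodule K (C.V i))
    (hP : ∀ i, ∀ x ∈ P i, C.d i x ∈ P (i + 1)) {i j : ℤ} (h : i = j) (x : C.V i) :
    castL K (quotOf C P hP).V h (Submodule.mkQ (P i) x) =
      Submodule.mkQ (P j) (castL K C.V h x) := by
  subst h; rfl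

section coker
variable (W : Cx K) (U S T : ∀ i, Submodule K (W.V i))
    (hU : ∀ i, ∀ x ∈ U i, W.d i x ∈ U (i + 1))
    (hS : ∀ i, ∀ x ∈ S i, W.d i x ∈ S (i + 1))
    (hT : ∀ i, ∀ x ∈ T i, W.d i x ∈ T (i + 1))

/-- The quotient complex `T/U`. -/
abbrev TmodU : Cx K :=
  quotOf (subCx W T hT) (fun i => (U i).comap (T i).subtype) (fun i x hx => hU i x.1 hx)

/-- The projection from `L_{U,S,W}` to `Hom*(T/U, W/T)`. -/
def sigmaMap (hUT : ∀ i, U i ≤ T i) (n : ℤ) : ↥(presSub W U n ⊓ presSub W S n) →ₗ[K]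
    homV (TmodU W U T hU hT) (quotOf W T hT) n where
  toFun f := fun j => Submodule.mapQ ((U j).comap (T j).subtype) (T (j + n))
    (f.1 j ∘ₗ (T j).subtype) (fun x hx => hUT _ (f.2.1 j x.1 hx))
  map_add' f g := by
    funext j
    apply Submodule.linearMap_qext
    rfl
  map_smul' c f := by
    funext j
    apply Submodule.linearMap_qext
    rfl

lemma sigmaMap_mk (hUT : ∀ i, U i ≤ T i) (n : ℤ) (f : ↥(presSub W U n ⊓ presSub W S n))
    (j : ℤ) (x : T j) :
    sigmaMap W U S T hU hT hUT n f j (Submodule.mkQ ((U j).comap (T j).subtype) x) =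
      Submodule.mkQ (T (j + n)) (f.1 j x.1) := rfl

lemma sigmaMap_chain (hUT : ∀ i, U i ≤ T i) (n : ℤ) (f : ↥(presSub W U n ⊓ presSub W S n)) :
    sigmaMap W U S T hU hT hUT (n + 1) ((presCx2 W U S hU hS).d n f) =
      homD (TmodU W U T hU hT) (quotOf W T hT) n (sigmaMap W U S T hU hT hUT n f) := by
  funext j
  ext x
  obtain ⟨x, rfl⟩ := Submodule.mkQ_surjective _ x
  refine Eq.trans ?_ (homD_apply _ _ _ _ _ _).symm
  change Submodule.mkQ (T (j + (n + 1))) (homD W W n f.1 j x.1) =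
    castL K (quotOf W T hT).V _ (Submodule.mkQ (T (j + n + 1)) (W.d (j + n) (f.1 j x.1))) -
    (-1 : K) ^ n • castL K (quotOf W T hT).V _
      (Submodule.mkQ (T (j + 1 + n)) (f.1 (j + 1) (W.d j x.1)))
  rw [castL_mkQ, castL_mkQ, homD_apply]
  rfl

lemma sigmaMap_surj (hUT : ∀ i, U i = S i ⊓ T i) (hUT' : ∀ i, U i ≤ T i) (n : ℤ) :
    Function.Surjective (sigmaMap W U S T hU hT hUT' n) := by
  intro g
  have : ∀ j, ∃ f : W.V j →ₗ[K] W.V (j + n), (∀ x ∈ S j, f x = 0) ∧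
      ∀ x : T j, Submodule.mkQ (T (j + n)) (f x.1) =
        g j (Submodule.mkQ ((U j).comap (T j).subtype) x) := by
    intro j
    obtain ⟨r, hr⟩ := (Submodule.mkQ (T (j + n))).exists_rightInverse_of_surjective
      (Submodule.range_mkQ _)
    -- `T/U → W/S` is injective
    let i : (T j ⧸ (U j).comap (T j).subtype) →ₗ[K] (W.V j ⧸ S j) :=
      Submodule.mapQ _ (S j) (T j).subtype (fun x hx => by
        have hx' : x.1 ∈ U j := hx
        rw [hUT] at hx'
        exact hx'.1)
    have hi : LinearMap.ker i = ⊥ := by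
      rw [LinearMap.ker_eq_bot']
      intro m hm
      obtain ⟨x, rfl⟩ := Submodule.mkQ_surjective _ m
      have hm' : Submodule.mkQ (S j) x.1 = 0 := hm
      rw [Submodule.mkQ_apply, Submodule.Quotient.mk_eq_zero] at hm'
      rw [Submodule.mkQ_apply, Submodule.Quotient.mk_eq_zero]
      change x.1 ∈ U j
      rw [hUT]
      exact ⟨hm', x.2⟩
    obtain ⟨l, hl⟩ := i.exists_leftInverse_of_injective hi
    let g' : (T j ⧸ (U j).comap (T j).subtype) →ₗ[K] (W.V (j + n) ⧸ T (j + n)) := g j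
    refine ⟨r ∘ₗ g' ∘ₗ l ∘ₗ Submodule.mkQ (S j), ?_, ?_⟩
    · intro x hx
      have : Submodule.mkQ (S j) x = 0 := by
        rw [Submodule.mkQ_apply, Submodule.Quotient.mk_eq_zero]; exact hx
      simp only [LinearMap.comp_apply, this, map_zero]
    · intro x
      have h1 : l (Submodule.mkQ (S j) x.1) = Submodule.mkQ ((U j).comap (T j).subtype) x :=
        LinearMap.congr_fun hl (Submodule.mkQ ((U j).comap (T j).subtype) x)
      simp only [LinearMap.comp_apply]
      rw [h1]
      exact LinearMap.congr_fun hr _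
  choose f hf0 hf using this
  refine ⟨⟨f, fun j x hx => ?_, fun j x hx => ?_⟩, ?_⟩
  · have hx' := hx
    rw [hUT] at hx'
    rw [hf0 j x hx'.1]; exact zero_mem _
  · rw [hf0 j x hx]; exact zero_mem _
  · funext j
    ext x
    obtain ⟨x, rfl⟩ := Submodule.mkQ_surjective _ x
    exact hf j x

lemma sigmaMap_ker (hUT' : ∀ i, U i ≤ T i) (n : ℤ) (f : ↥(presSub W U n ⊓ presSub W S n)) :
    sigmaMap W U S T hU hT hUT' n f = 0 ↔ f.1 ∈ presSub W T n := by
  constructor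
  · intro h j x hx
    have := LinearMap.congr_fun (congrFun h j)
      (Submodule.mkQ ((U j).comap (T j).subtype) ⟨x, hx⟩)
    have h2 : Submodule.mkQ (T (j + n)) (f.1 j x) = 0 := this
    rwa [Submodule.mkQ_apply, Submodule.Quotient.mk_eq_zero] at h2
  · intro h
    funext j
    ext x
    obtain ⟨x, rfl⟩ := Submodule.mkQ_surjective _ x
    change Submodule.mkQ (T (j + n)) (f.1 j x.1) = 0
    rw [Submodule.mkQ_apply, Submodule.Quotient.mk_eq_zero]
    exact h j x.1 x.2

end coker

lemma pres2_isComplex (W : Cx K) (hW : W.IsComplex) (S T : ∀ i, Submodule K (W.V i))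
    (hS : ∀ i, ∀ x ∈ S i, W.d i x ∈ S (i + 1))
    (hT : ∀ i, ∀ x ∈ T i, W.d i x ∈ T (i + 1)) : (presCx2 W S T hS hT).IsComplex :=
  fun n f => Subtype.ext (homD_homD W W hW hW n f.1)

end helpers

/-- Let `U, V, Z` be subcomplexes of `W` with `U = V ∩ Z`, and assume that the
inclusions `U → V` and `Z → W` are quasi-isomorphisms.  Then the two inclusions
`α : L_{Z,W} ∩ L_{V,W} → L_{U,V,W}` and `β : L_{Z,W} ∩ L_{V,W} → L_{U,Z,W}` are
quasi-isomorphisms; indeed the cokernel of `α` is isomorphic, as a complex, to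
`Hom*(Z/U, W/Z)` (i.e. there is a degreewise surjective chain map
`σ : L_{U,V,W} → Hom*(Z/U, W/Z)` whose kernel is exactly `L_{Z,W} ∩ L_{V,W}`),
the cokernel of `β` is isomorphic to `Hom*(V/U, W/V)`, and these Hom complexes
are acyclic. -/
theorem cartesian_quasiIso (W : Cx K) (hW : W.IsComplex)
    (SV SZ : ∀ i, Submodule K (W.V i))
    (hV : ∀ i, ∀ x ∈ SV i, W.d i x ∈ SV (i + 1))
    (hZ : ∀ i, ∀ x ∈ SZ i, W.d i x ∈ SZ (i + 1))
    (hqUV : IsQuasiIso (subCx W (SUfam W SV SZ) (SUfam_pres W SV SZ hV hZ))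
      (subCx W SV hV) (fun i => Submodule.inclusion inf_le_left))
    (hqZW : IsQuasiIso (subCx W SZ hZ) W (fun i => (SZ i).subtype)) :
    (IsChainMap (presCx2 W SZ SV hZ hV)
        (presCx2 W (SUfam W SV SZ) SV (SUfam_pres W SV SZ hV hZ) hV)
        (fun n => Submodule.inclusion (presSub_ZV_le_UV W SV SZ n)) ∧
      IsQuasiIso (presCx2 W SZ SV hZ hV)
        (presCx2 W (SUfam W SV SZ) SV (SUfam_pres W SV SZ hV hZ) hV)
        (fun n => Submodule.inclusion (presSub_ZV_le_UV W SV SZ n))) ∧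
    (IsChainMap (presCx2 W SZ SV hZ hV)
        (presCx2 W (SUfam W SV SZ) SZ (SUfam_pres W SV SZ hV hZ) hZ)
        (fun n => Submodule.inclusion (presSub_ZV_le_UZ W SV SZ n)) ∧
      IsQuasiIso (presCx2 W SZ SV hZ hV)
        (presCx2 W (SUfam W SV SZ) SZ (SUfam_pres W SV SZ hV hZ) hZ)
        (fun n => Submodule.inclusion (presSub_ZV_le_UZ W SV SZ n))) ∧
    (∃ σ : ∀ n, ↥(presSub W (SUfam W SV SZ) n ⊓ presSub W SV n) →ₗ[K]
        homV (ZmodU W SV SZ hV hZ) (WmodZ W SZ hZ) n,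
      (∀ (n : ℤ) (f : ↥(presSub W (SUfam W SV SZ) n ⊓ presSub W SV n)),
        σ (n + 1) ((presCx2 W (SUfam W SV SZ) SV (SUfam_pres W SV SZ hV hZ) hV).d n f)
          = homD (ZmodU W SV SZ hV hZ) (WmodZ W SZ hZ) n (σ n f)) ∧
      (∀ n, Function.Surjective (σ n)) ∧
      (∀ n, LinearMap.ker (σ n) =
        (presSub W SZ n ⊓ presSub W SV n).comap
          (presSub W (SUfam W SV SZ) n ⊓ presSub W SV n).subtype)) ∧
    (∃ τ : ∀ n, ↥(presSub W (SUfam W SV SZ) n ⊓ presSub W SZ n) →ₗ[K]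
        homV (VmodU W SV SZ hV hZ) (WmodV W SV hV) n,
      (∀ (n : ℤ) (f : ↥(presSub W (SUfam W SV SZ) n ⊓ presSub W SZ n)),
        τ (n + 1) ((presCx2 W (SUfam W SV SZ) SZ (SUfam_pres W SV SZ hV hZ) hZ).d n f)
          = homD (VmodU W SV SZ hV hZ) (WmodV W SV hV) n (τ n f)) ∧
      (∀ n, Function.Surjective (τ n)) ∧
      (∀ n, LinearMap.ker (τ n) =
        (presSub W SZ n ⊓ presSub W SV n).comap
          (presSub W (SUfam W SV SZ) n ⊓ presSub W SZ n).subtype)) ∧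
    (homCx (ZmodU W SV SZ hV hZ) (WmodZ W SZ hZ)).Acyclic ∧
    (homCx (VmodU W SV SZ hV hZ) (WmodV W SV hV)).Acyclic := by
  have hU := SUfam_pres W SV SZ hV hZ
  have hUZ : ∀ i, SUfam W SV SZ i ≤ SZ i := fun i => inf_le_right
  have hUV : ∀ i, SUfam W SV SZ i ≤ SV i := fun i => inf_le_left
  have acZ : (homCx (ZmodU W SV SZ hV hZ) (WmodZ W SZ hZ)).Acyclic := by
    apply acyclic_hom_right
    · exact quot_isComplex W hW SZ hZ
    · exact quot_acyclic (subCx W SZ hZ) W hW (fun i => (SZ i).subtype) (fun i x => rfl)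
        (fun i => (SZ i).injective_subtype) hqZW SZ hZ
        (fun i b => ⟨fun hb => ⟨⟨b, hb⟩, rfl⟩, fun ⟨a, ha⟩ => ha ▸ a.2⟩)
  have acV : (homCx (VmodU W SV SZ hV hZ) (WmodV W SV hV)).Acyclic := by
    apply acyclic_hom_left
    · exact quot_isComplex _ (sub_isComplex W hW SV hV) _ _
    · exact quot_acyclic (subCx W (SUfam W SV SZ) hU) (subCx W SV hV)
        (sub_isComplex W hW SV hV) _ (fun i x => rfl)
        (fun i => Submodule.inclusion_injective _) hqUV _ _
        (fun i b => ⟨fun hb => ⟨⟨b.1, hb⟩, rfl⟩, fun ⟨a, ha⟩ => ha ▸ a.2⟩)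
  have sZ := sigmaMap_surj W (SUfam W SV SZ) SV SZ hU hZ (fun i => rfl) hUZ
  have sV := sigmaMap_surj W (SUfam W SV SZ) SZ SV hU hV (fun i => inf_comm _ _) hUV
  have cZ := sigmaMap_chain W (SUfam W SV SZ) SV SZ hU hV hZ hUZ
  have cV := sigmaMap_chain W (SUfam W SV SZ) SZ SV hU hZ hV hUV
  have kZ := sigmaMap_ker W (SUfam W SV SZ) SV SZ hU hZ hUZ
  have kV := sigmaMap_ker W (SUfam W SV SZ) SZ SV hU hV hUV
  refine ⟨⟨fun _ _ => rfl, ?_⟩, ⟨fun _ _ => rfl, ?_⟩, ⟨_, cZ, sZ, ?_⟩, ⟨_, cV, sV, ?_⟩, acZ, acV⟩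
  · exact quasiIso_of_coker _ _ (homCx (ZmodU W SV SZ hV hZ) (WmodZ W SZ hZ))
      (pres2_isComplex W hW _ _ _ _) _ (fun _ _ => rfl)
      (fun i => Submodule.inclusion_injective _)
      (sigmaMap W (SUfam W SV SZ) SV SZ hU hZ hUZ) cZ sZ
      (fun n f => (kZ n f).trans
        ⟨fun h => ⟨⟨f.1, h, f.2.2⟩, rfl⟩, fun ⟨a, ha⟩ => ha ▸ a.2.1⟩) acZ
  · exact quasiIso_of_coker _ _ (homCx (VmodU W SV SZ hV hZ) (WmodV W SV hV))
      (pres2_isComplex W hW _ _ _ _) _ (fun _ _ => rfl)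
      (fun i => Submodule.inclusion_injective _)
      (sigmaMap W (SUfam W SV SZ) SZ SV hU hV hUV) cV sV
      (fun n f => (kV n f).trans
        ⟨fun h => ⟨⟨f.1, f.2.2, h⟩, rfl⟩, fun ⟨a, ha⟩ => ha ▸ a.2.2⟩) acV
  · intro n
    ext f
    exact (kZ n f).trans ⟨fun h => ⟨h, f.2.2⟩, fun h => h.1⟩
  · intro n
    ext f
    exact (kV n f).trans ⟨fun h => ⟨f.2.2, h⟩, fun h => h.2⟩
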